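/- Let n ≥ 2 be an integer. Assume that over every algebraically closed field of characteristic 0, every Casas–Alvero polynomial of degree n is an n-th power of a linear polynomial. Then every bad prime p for n satisfies p < C! · ∏_{i=1}^{n−1} binom(i+n−2, n−2)^{binom(d−i+n−2, n−2)}, where d = (n²−3n+4)/2 and C = binom((n²−n)/2, n−2). -/

import Mathlib

open Polynomial MvPolynomial

/-- `f` is a Casas–Alvero polynomial of degree `n`: it is monic of degree `n` and for each
`i ∈ {1, …, n-1}` it has a nonconstant common factor with its `i`-th Hasse derivative. -/
def IsCasasAlvero {K : Type} [Field K] (n : ℕ) (f : K[X]) : Prop :=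
  f.Monic ∧ f.natDegree = n ∧
    ∀ i ∈ Finset.Ioo 0 n,
      ∃ g : K[X], 0 < g.degree ∧ g ∣ f ∧ g ∣ Polynomial.hasseDeriv i f

/-- `p` is a bad prime for `n`: `p` is prime and there are an algebraically closed field `K` of
characteristic `p` and a Casas–Alvero polynomial of degree `n` over `K` which is not an `n`-th
power of a linear polynomial. -/
def IsBadPrime (n p : ℕ) : Prop :=
  p.Prime ∧ ∃ (K : Type) (_ : Field K), IsAlgClosed K ∧ CharP K p ∧
    ∃ f : K[X], IsCasasAlvero n f ∧ ¬ ∃ b : K, f = (Polynomial.X - Polynomial.C b) ^ n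

/-- The involution `Φ_j` on `K[x_1,…,x_m]`, sending `x_i ↦ x_i - x_j` for `i ≠ j` and
`x_j ↦ -x_j`. -/
noncomputable def Phi (K : Type) [CommRing K] {m : ℕ} (j : Fin m) :
    MvPolynomial (Fin m) K →ₐ[K] MvPolynomial (Fin m) K :=
  MvPolynomial.aeval fun i =>
    if i = j then -MvPolynomial.X j else MvPolynomial.X i - MvPolynomial.X j

/-- `Φ_j` for `j ∈ {1,…,n}` acting on `K[x_1,…,x_{n-1}]`; for `j = n` (the last index of `Fin n`)
this is the identity. -/
noncomputable def PhiFull (K : Type) [CommRing K] (n : ℕ) (j : Fin n) :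
    MvPolynomial (Fin (n - 1)) K →ₐ[K] MvPolynomial (Fin (n - 1)) K :=
  if h : (j : ℕ) < n - 1 then Phi K ⟨j, h⟩ else AlgHom.id K _

/-- `G_{T,i} = Φ_{j_i}(σ_i)`, where `i` ranges over `Fin (n-1)` (representing the degree `i+1`). -/
noncomputable def G (K : Type) [CommRing K] (n : ℕ) (T : Fin (n - 1) → Fin n)
    (i : Fin (n - 1)) : MvPolynomial (Fin (n - 1)) K :=
  PhiFull K n (T i) (MvPolynomial.esymm (Fin (n - 1)) K ((i : ℕ) + 1))

/-- `d = (n² - 3n + 4)/2`. -/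
def casasD (n : ℕ) : ℕ := (n ^ 2 - 3 * n + 4) / 2

/-- `C = binom((n²-n)/2, n-2)`, the number of monomials of degree `d` in `n-1` variables. -/
def casasC (n : ℕ) : ℕ := Nat.choose ((n ^ 2 - n) / 2) (n - 2)

/-- `D = Σ_{i=1}^{n-1} binom(d-i+n-2, n-2)`, the number of rows of `M_T`. -/
def casasDD (n : ℕ) : ℕ :=
  ∑ i ∈ Finset.Icc 1 (n - 1), Nat.choose (casasD n - i + n - 2) (n - 2)

/-- The matrix `M_T` over `ℤ`, whose rows, indexed by pairs `(i, α)` with `|α| = d - i`, are the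
coefficient vectors of `x^α · G_{T,i}` with respect to the monomials of degree `d`
(a monomial of degree `e` in `n-1` variables is encoded as an element of `Sym (Fin (n-1)) e`). -/
noncomputable def casasM (n : ℕ) (T : Fin (n - 1) → Fin n) :
    Matrix ((i : Fin (n - 1)) × Sym (Fin (n - 1)) (casasD n - ((i : ℕ) + 1)))
      (Sym (Fin (n - 1)) (casasD n)) ℤ :=
  fun r c =>
    MvPolynomial.coeff (Multiset.toFinsupp (c : Multiset (Fin (n - 1))))
      (MvPolynomial.monomial (Multiset.toFinsupp (r.2 : Multiset (Fin (n - 1)))) 1 * G ℤ n T r.1)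

/-- `J_T`: the greatest common divisor of all `C × C` minors of `M_T`. -/
noncomputable def casasJ (n : ℕ) (T : Fin (n - 1) → Fin n) : ℤ :=
  Finset.gcd (Finset.univ.filter fun
      f : Sym (Fin (n - 1)) (casasD n) →
        (i : Fin (n - 1)) × Sym (Fin (n - 1)) (casasD n - ((i : ℕ) + 1)) =>
      Function.Injective f)
    fun f => ((casasM n T).submatrix f id).det

/-- The upper bound `C! · ∏_{i=1}^{n-1} binom(i+n-2, n-2)^binom(d-i+n-2, n-2)`. -/
def casasBound (n : ℕ) : ℕ :=
  (casasC n).factorial * ∏ i ∈ Finset.Icc 1 (n - 1),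
    Nat.choose (i + n - 2) (n - 2) ^ Nat.choose (casasD n - i + n - 2) (n - 2)


namespace CasasAux

theorem koszul {σ R S : Type*} [Fintype σ] [CommRing R] [CommRing S]
    (π : MvPolynomial σ R →+* S) (φ : σ → S)
    (h : ∀ a b, π (MvPolynomial.X a) * φ b = π (MvPolynomial.X b) * φ a)
    (v : σ → MvPolynomial σ R) (hv : ∑ i, MvPolynomial.X i * v i = 0) :
    ∑ i, π (v i) * φ i = 0 := by
  classical
  let _ : Algebra R S := (π.comp MvPolynomial.C).toAlgebra
  have hsm : ∀ (r : R) (s : S), r • s = π (MvPolynomial.C r) * s := fun r s => by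
    rw [Algebra.smul_def]; rfl
  let t : (σ →₀ ℕ) → S := fun α =>
    if h : ∃ a, α a ≠ 0 then
      π (MvPolynomial.monomial (α - Finsupp.single h.choose 1) 1) * φ h.choose else 0
  have ht : ∀ (β : σ →₀ ℕ) (i : σ),
      t (β + Finsupp.single i 1) = π (MvPolynomial.monomial β 1) * φ i := by
    intro β i
    have hex : ∃ a, (β + Finsupp.single i 1 : σ →₀ ℕ) a ≠ 0 := ⟨i, by simp⟩
    have hc := hex.choose_spec
    simp only [t, dif_pos hex]
    generalize hex.choose = a at hc
    by_cases hai : a = i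
    · subst hai; simp
    · have hβ : β a ≠ 0 := by simpa [Finsupp.single_apply, Ne.symm hai] using hc
      obtain ⟨γ, rfl⟩ : ∃ γ, β = γ + Finsupp.single a 1 :=
        ⟨β - Finsupp.single a 1, by
          rw [tsub_add_cancel_of_le]; simpa using Nat.one_le_iff_ne_zero.2 hβ⟩
      have e1 : γ + Finsupp.single a 1 + Finsupp.single i 1 - Finsupp.single a 1
          = γ + Finsupp.single i 1 := by
        rw [add_right_comm, add_tsub_cancel_right]
      rw [e1]
      have e2 : ∀ j : σ, (MvPolynomial.monomial (γ + Finsupp.single j 1) (1 : R))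
          = MvPolynomial.monomial γ 1 * MvPolynomial.X j := by
        intro j; rw [MvPolynomial.X, MvPolynomial.monomial_mul, mul_one]
      rw [e2, e2, map_mul, map_mul, mul_assoc, mul_assoc, h]
  let Θ : MvPolynomial σ R →ₗ[R] S := (MvPolynomial.basisMonomials σ R).constr R t
  have hΘ : ∀ (α : σ →₀ ℕ) (r : R), Θ (MvPolynomial.monomial α r) = r • t α := by
    intro α r
    have : MvPolynomial.monomial α r = r • (MvPolynomial.basisMonomials σ R α) := by
      simp [MvPolynomial.coe_basisMonomials, MvPolynomial.smul_monomial]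
    rw [this, map_smul, Module.Basis.constr_basis]
  have key : ∀ (i : σ) (q : MvPolynomial σ R), Θ (MvPolynomial.X i * q) = π q * φ i := by
    intro i q
    induction q using MvPolynomial.induction_on' with
    | monomial β r =>
      rw [mul_comm, MvPolynomial.X, MvPolynomial.monomial_mul, mul_one, hΘ, ht, hsm, ← mul_assoc,
        ← map_mul, MvPolynomial.C_mul_monomial, mul_one]
    | add p q hp hq => rw [mul_add, map_add, hp, hq, map_add, add_mul]
  calc ∑ i, π (v i) * φ i = Θ (∑ i, MvPolynomial.X i * v i) := by
        rw [map_sum]; exact Finset.sum_congr rfl fun i _ => (key i _).symm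
    _ = 0 := by rw [hv, map_zero]

/-- translated version -/
theorem koszul' {σ R S : Type*} [Fintype σ] [CommRing R] [CommRing S] (y : σ → R)
    (π : MvPolynomial σ R →+* S) (φ : σ → S)
    (h : ∀ a b, π (MvPolynomial.X a - MvPolynomial.C (y a)) * φ b
      = π (MvPolynomial.X b - MvPolynomial.C (y b)) * φ a)
    (v : σ → MvPolynomial σ R)
    (hv : ∑ i, (MvPolynomial.X i - MvPolynomial.C (y i)) * v i = 0) :
    ∑ i, π (v i) * φ i = 0 := by
  let τ : MvPolynomial σ R →ₐ[R] MvPolynomial σ R :=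
    MvPolynomial.aeval fun i => MvPolynomial.X i + MvPolynomial.C (y i)
  let τ' : MvPolynomial σ R →ₐ[R] MvPolynomial σ R :=
    MvPolynomial.aeval fun i => MvPolynomial.X i - MvPolynomial.C (y i)
  have hτC : ∀ r, τ (MvPolynomial.C r) = MvPolynomial.C r := fun r => by
    simp [τ, MvPolynomial.algebraMap_eq]
  have hττ : ∀ q, τ' (τ q) = q := by
    intro q
    have : τ'.comp τ = AlgHom.id R _ := by
      apply MvPolynomial.algHom_ext
      intro i
      simp [τ, τ', MvPolynomial.algebraMap_eq]
    exact DFunLike.congr_fun this q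
  have := koszul (π.comp τ'.toRingHom) φ (by
    intro a b
    simpa [τ'] using h a b) (fun i => τ (v i)) (by
    have := congrArg τ hv
    simpa [map_sum, hτC, τ, MvPolynomial.algebraMap_eq] using this)
  simpa [hττ] using this

theorem det_mul_vec {σ S : Type*} [Fintype σ] [DecidableEq σ] [CommRing S] (M : Matrix σ σ S)
    (z : σ → S) (a : σ) : M.det * z a = (M.adjugate.mulVec (M.mulVec z)) a := by
  rw [Matrix.mulVec_mulVec, Matrix.adjugate_mul]; simp [Matrix.smul_mulVec]

/-- replacing one row -/
theorem det_row {σ R S : Type*} [Fintype σ] [DecidableEq σ] [CommRing R] [CommRing S] (y : σ → R)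
    (π : MvPolynomial σ R →+* S)
    (A : Matrix σ σ S) (i : σ)
    (hA : ∀ r, r ≠ i → ∑ k, A r k * π (MvPolynomial.X k - MvPolynomial.C (y k)) = 0)
    (v : σ → MvPolynomial σ R)
    (hv : ∑ k, (MvPolynomial.X k - MvPolynomial.C (y k)) * v k = 0) :
    (A.updateRow i (fun k => π (v k))).det = 0 := by
  have e : (fun k => π (v k)) = ∑ k, π (v k) • (Pi.single k 1 : σ → S) := by
    ext k; simp [Finset.sum_apply, Pi.single_apply]
  have h1 : (A.updateRow i (fun k => π (v k))).det
      = ∑ k, π (v k) * (A.updateRow i (Pi.single k 1)).det := by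
    rw [e]
    have := map_sum ((Matrix.detRowAlternating (n := σ) (R := S)).toMultilinearMap.toLinearMap A i)
      (fun k => π (v k) • (Pi.single k 1 : σ → S)) Finset.univ
    simp only [map_smul] at this
    exact this
  rw [h1]
  apply koszul' y π _ _ v hv
  intro a b
  have hz := det_mul_vec (A.updateRow i (Pi.single b 1))
    (fun k => π (MvPolynomial.X k - MvPolynomial.C (y k))) a
  have hM : (A.updateRow i (Pi.single b 1)).mulVec
      (fun k => π (MvPolynomial.X k - MvPolynomial.C (y k)))
      = Pi.single i (π (MvPolynomial.X b - MvPolynomial.C (y b))) := by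
    ext r
    by_cases hr : r = i
    · subst hr; simp [Matrix.mulVec, dotProduct, Pi.single_apply]
    · simpa [Matrix.mulVec, dotProduct, hr] using hA r hr
  rw [hM] at hz
  simp only [Matrix.mulVec_single, Matrix.adjugate_apply, Matrix.updateRow_idem,
    Pi.smul_apply, Matrix.col_apply, MulOpposite.smul_eq_mul_unop, MulOpposite.unop_op] at hz
  rw [mul_comm, hz, mul_comm]

theorem det_congr {σ R S : Type*} [Fintype σ] [DecidableEq σ] [CommRing R] [CommRing S] (y : σ → R)
    (π : MvPolynomial σ R →+* S) (A B : Matrix σ σ (MvPolynomial σ R)) (w : σ → MvPolynomial σ R)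
    (hw : ∀ i, π (w i) = 0)
    (hA : ∀ r, ∑ k, A r k * (MvPolynomial.X k - MvPolynomial.C (y k)) = w r)
    (hB : ∀ r, ∑ k, B r k * (MvPolynomial.X k - MvPolynomial.C (y k)) = w r) :
    π A.det = π B.det := by
  have hAS : ∀ r, ∑ k, π (A r k) * π (MvPolynomial.X k - MvPolynomial.C (y k)) = 0 := by
    intro r; rw [← hw r, ← hA r, map_sum]; simp only [map_mul]
  have hBS : ∀ r, ∑ k, π (B r k) * π (MvPolynomial.X k - MvPolynomial.C (y k)) = 0 := by
    intro r; rw [← hw r, ← hB r, map_sum]; simp only [map_mul]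
  let M : Finset σ → Matrix σ σ S := fun s =>
    Matrix.of fun r k => if r ∈ s then π (B r k) else π (A r k)
  have key : ∀ s, (M s).det = (M ∅).det := by
    intro s
    induction s using Finset.induction_on with
    | empty => rfl
    | insert i s hi ih =>
      rw [← ih]
      have e1 : M (insert i s) = (M s).updateRow i (fun k => π (B i k)) := by
        ext r k
        by_cases hr : r = i
        · subst hr; simp [M]
        · simp [M, hr, Matrix.updateRow_ne]
      have e2 : (fun k => π (B i k)) = (M s) i + (fun k => π (B i k - A i k)) := by
        ext k; simp [M, hi]
      rw [e1, e2, Matrix.det_updateRow_add, Matrix.updateRow_eq_self,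
        det_row y π (M s) i _ (fun k => B i k - A i k) _, add_zero]
      · intro r _
        by_cases hr : r ∈ s
        · simpa [M, hr] using hBS r
        · simpa [M, hr] using hAS r
      · have := (hB i).trans (hA i).symm
        rw [← sub_eq_zero, ← Finset.sum_sub_distrib] at this
        rw [← this]
        exact Finset.sum_congr rfl fun k _ => by ring
  have h1 := key Finset.univ
  rw [RingHom.map_det, RingHom.map_det]
  convert h1.symm using 2
  · ext r k; simp [M]
  · ext r k; simp [M]

/-- Wiebe-type statement. -/
theorem wiebe {σ k R : Type*} [Fintype σ] [DecidableEq σ] [CommRing k] [CommRing R]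
    (mk : MvPolynomial σ k →+* R) (f : σ → MvPolynomial σ k) (c : Matrix σ σ (MvPolynomial σ k)) (N : ℕ)
    (hN : 0 < N) (hmkf : ∀ j, mk (f j) = 0)
    (hc : ∀ i, MvPolynomial.X i ^ N = ∑ j, c i j * f j)
    (h : MvPolynomial σ k)
    (hh : h * c.det ∈ Ideal.span (Set.range fun i : σ => (MvPolynomial.X i : MvPolynomial σ k) ^ N)) :
    mk h = 0 := by
  let y : σ → R := fun i => mk (MvPolynomial.X i)
  let z : σ → (MvPolynomial σ R) := fun i => MvPolynomial.X i - MvPolynomial.C (y i)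
  let ex : MvPolynomial σ k →+* (MvPolynomial σ R) := MvPolynomial.map (mk.comp MvPolynomial.C)
  have hexX : ∀ i, ex (MvPolynomial.X i) = MvPolynomial.X i := fun i => by simp [ex]
  have hdiff : ∀ g : MvPolynomial σ k, ex g - MvPolynomial.C (mk g) ∈ Ideal.span (Set.range z) := by
    intro g
    rw [← Ideal.Quotient.eq]
    have : (Ideal.Quotient.mk (Ideal.span (Set.range z))).comp ex =
        (Ideal.Quotient.mk (Ideal.span (Set.range z))).comp (MvPolynomial.C.comp mk) := by
      apply MvPolynomial.ringHom_ext
      · intro r; simp [ex]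
      · intro i
        simp only [RingHom.comp_apply, hexX]
        rw [Ideal.Quotient.eq]
        exact Ideal.subset_span ⟨i, rfl⟩
    exact DFunLike.congr_fun this g
  have hex : ∀ g : MvPolynomial σ k, ∃ u : σ → (MvPolynomial σ R), ∑ i, u i * z i = ex g - MvPolynomial.C (mk g) :=
    fun g => (Ideal.mem_span_range_iff_exists_fun).1 (hdiff g)
  choose u hu using hex
  have hyN : ∀ i, y i ^ N = 0 := by
    intro i
    simp only [y]
    rw [← map_pow, hc, map_sum]
    exact Finset.sum_eq_zero fun j _ => by rw [map_mul, hmkf, mul_zero]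
  let a : Matrix σ σ (MvPolynomial σ R) := fun j l => u (f j) l
  have ha : ∀ j, ∑ l, a j l * z l = ex (f j) := by
    intro j; simp only [a]; rw [hu, hmkf, map_zero, sub_zero]
  let E : Matrix σ σ (MvPolynomial σ R) := (c.map ex) * a
  let W : Ideal (MvPolynomial σ R) := Ideal.span (Set.range fun i : σ => (MvPolynomial.X i : (MvPolynomial σ R)) ^ N)
  let Δ : σ → (MvPolynomial σ R) := fun i =>
    ∑ l ∈ Finset.range N, MvPolynomial.X i ^ l * MvPolynomial.C (y i) ^ (N - 1 - l)
  have hΔ : ∀ i, Δ i * z i = MvPolynomial.X i ^ N := by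
    intro i
    simp only [Δ, z]
    rw [(Commute.all _ _).geom_sum₂_mul, ← MvPolynomial.C_pow, hyN, map_zero, sub_zero]
  have hE : ∀ r, ∑ l, E r l * z l = MvPolynomial.X r ^ N := by
    intro r
    have := congrArg ex (hc r)
    rw [map_pow, hexX] at this
    rw [this, map_sum]
    simp only [E, Matrix.mul_apply, Finset.sum_mul]
    rw [Finset.sum_comm]
    refine Finset.sum_congr rfl fun j _ => ?_
    rw [map_mul, ← ha j, Finset.mul_sum]
    exact Finset.sum_congr rfl fun l _ => by simp [mul_assoc]
  have hdet := det_congr y (Ideal.Quotient.mk W) E (Matrix.diagonal Δ)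
    (fun i => MvPolynomial.X i ^ N)
    (fun i => Ideal.Quotient.eq_zero_iff_mem.2 (Ideal.subset_span ⟨i, rfl⟩)) hE
    (fun r => by
      rw [← hΔ r]
      simp [Matrix.diagonal_apply, z])
  have hhx : ex h * (c.map ex).det ∈ W := by
    have := Ideal.mem_map_of_mem ex hh
    rw [Ideal.map_span, ← Set.range_comp, map_mul, RingHom.map_det] at this
    simpa [Function.comp_def, hexX] using this
  have h1 : ex h * ∏ i, Δ i ∈ W := by
    rw [← Ideal.Quotient.eq_zero_iff_mem]
    rw [Matrix.det_diagonal] at hdet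
    rw [map_mul, ← hdet, ← map_mul, Ideal.Quotient.eq_zero_iff_mem]
    simp only [E]
    rw [Matrix.det_mul, ← mul_assoc]
    exact W.mul_mem_right _ hhx
  have h2 : MvPolynomial.C (mk h) * ∏ i, Δ i ∈ W := by
    have : MvPolynomial.C (mk h) * ∏ i, Δ i
        = ex h * ∏ i, Δ i - (∑ l, u h l * z l) * ∏ i, Δ i := by rw [hu]; ring
    rw [this]
    refine W.sub_mem h1 ?_
    rw [Finset.sum_mul]
    refine W.sum_mem fun l _ => ?_
    rw [← Finset.mul_prod_erase _ _ (Finset.mem_univ l)]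
    have : u h l * z l * (Δ l * ∏ x ∈ Finset.univ.erase l, Δ x)
      = (u h l * ∏ x ∈ Finset.univ.erase l, Δ x) * (Δ l * z l) := by ring
    rw [this, hΔ]
    exact W.mul_mem_left _ (Ideal.subset_span ⟨l, rfl⟩)
  let top : σ →₀ ℕ := Finsupp.equivFunOnFinite.symm fun _ => N - 1
  have h3 : MvPolynomial.coeff top (∏ i, Δ i) = 1 := by
    simp only [Δ]
    rw [Finset.prod_univ_sum, MvPolynomial.coeff_sum]
    have hterm : ∀ p : σ → ℕ, MvPolynomial.coeff top
        (∏ i, (MvPolynomial.X i ^ p i * MvPolynomial.C (y i) ^ (N - 1 - p i) : (MvPolynomial σ R)))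
        = if (Finsupp.equivFunOnFinite.symm p) = top then ∏ i, y i ^ (N - 1 - p i) else 0 := by
      intro p
      have : (∏ i, (MvPolynomial.X i ^ p i * MvPolynomial.C (y i) ^ (N - 1 - p i) : (MvPolynomial σ R)))
          = MvPolynomial.monomial (Finsupp.equivFunOnFinite.symm p) (∏ i, y i ^ (N - 1 - p i)) := by
        rw [MvPolynomial.monomial_eq, Finset.prod_mul_distrib, mul_comm, map_prod,
          Finsupp.prod_fintype _ _ (by simp)]
        simp
      rw [this, MvPolynomial.coeff_monomial]
    simp only [hterm]
    rw [Finset.sum_eq_single (fun _ => N - 1)]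
    · simp [top]
    · intro p _ hp
      rw [if_neg]
      intro hpt
      exact hp (Finsupp.equivFunOnFinite.symm.injective hpt)
    · intro hn
      exfalso; apply hn
      simp only [Fintype.mem_piFinset, Finset.mem_range]
      intro _; omega
  · by_contra hne
    have hW : W = Ideal.span ((fun s => MvPolynomial.monomial s (1 : R)) ''
        (Set.range fun i : σ => Finsupp.single i N)) := by
      simp only [W]
      rw [← Set.range_comp]
      congr 1
      congr 1
      ext i
      simp [MvPolynomial.X_pow_eq_monomial]
    rw [hW, MvPolynomial.mem_ideal_span_monomial_image] at h2
    obtain ⟨s, ⟨i, rfl⟩, hs⟩ := h2 top (by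
      rw [MvPolynomial.mem_support_iff, MvPolynomial.coeff_C_mul, h3, mul_one]; exact hne)
    have := hs i
    simp [top] at this
    omega

theorem homComp_mul {σ k : Type*} [CommRing k] (a b : MvPolynomial σ k) (i n : ℕ)
    (hb : b.IsHomogeneous i) (h : i ≤ n) :
    MvPolynomial.homogeneousComponent n (a * b)
      = MvPolynomial.homogeneousComponent (n - i) a * b := by
  classical
  let _ := MvPolynomial.gradedAlgebra (σ := σ) (R := k)
  have hd : ∀ (q : MvPolynomial σ k) (j : ℕ),
      (DirectSum.decompose (MvPolynomial.homogeneousSubmodule σ k) q j : MvPolynomial σ k)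
        = MvPolynomial.homogeneousComponent j q := fun q j =>
    MvPolynomial.decomposition.decompose'_apply q j
  have := DirectSum.coe_decompose_mul_of_right_mem_of_le
    (𝒜 := MvPolynomial.homogeneousSubmodule σ k) (a := a) (b := b) hb h
  rwa [hd, hd] at this

/-- a homogeneous element of the ideal is a combination with homogeneous coefficients. -/
theorem hom_coeffs {σ ι k : Type*} [Fintype ι] [CommRing k] (f : ι → MvPolynomial σ k)
    (e : ι → ℕ) (hf : ∀ i, (f i).IsHomogeneous (e i)) (N : ℕ) (hN : ∀ i, e i ≤ N)
    (g : MvPolynomial σ k) (hg : g.IsHomogeneous N) (hmem : g ∈ Ideal.span (Set.range f)) :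
    ∃ c : ι → MvPolynomial σ k, (∀ i, (c i).IsHomogeneous (N - e i)) ∧ g = ∑ i, c i * f i := by
  obtain ⟨c, hc⟩ := (Ideal.mem_span_range_iff_exists_fun).1 hmem
  refine ⟨fun i => MvPolynomial.homogeneousComponent (N - e i) (c i),
    fun i => MvPolynomial.homogeneousComponent_isHomogeneous _ _, ?_⟩
  rw [← MvPolynomial.homogeneousComponent_eq_self hg, ← hc, map_sum]
  exact Finset.sum_congr rfl fun i _ => homComp_mul _ _ _ _ (hf i) (hN i)

theorem macaulay {σ k : Type*} [Fintype σ] [DecidableEq σ] [CommRing k]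
    (f : σ → MvPolynomial σ k) (e : σ → ℕ) (hf : ∀ i, (f i).IsHomogeneous (e i))
    (he : ∀ i, 1 ≤ e i)
    (hX : ∀ i, MvPolynomial.X i ∈ (Ideal.span (Set.range f)).radical)
    (d : ℕ) (hd : ∑ i, (e i - 1) + 1 ≤ d)
    (h : MvPolynomial σ k) (hh : h.IsHomogeneous d) :
    h ∈ Ideal.span (Set.range f) := by
  choose n hn using hX
  let N := ∑ i, n i + ∑ i, e i + 1
  have hnN : ∀ i, n i ≤ N := fun i => by
    have := Finset.single_le_sum (fun i _ => Nat.zero_le (n i)) (Finset.mem_univ i)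
    simp only [N]; omega
  have heN : ∀ i, e i ≤ N := fun i => by
    have := Finset.single_le_sum (fun i _ => Nat.zero_le (e i)) (Finset.mem_univ i)
    simp only [N]; omega
  have hXN : ∀ i, (MvPolynomial.X i : MvPolynomial σ k) ^ N ∈ Ideal.span (Set.range f) := fun i =>
    Ideal.pow_mem_of_pow_mem _ (hn i) (hnN i)
  have := fun i => hom_coeffs f e hf N heN _ (MvPolynomial.isHomogeneous_X_pow i N) (hXN i)
  choose c0 hc1 hc2 using this
  let c : Matrix σ σ (MvPolynomial σ k) := Matrix.of c0
  rw [← Ideal.Quotient.eq_zero_iff_mem]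
  refine wiebe (Ideal.Quotient.mk (Ideal.span (Set.range f))) f c N (by simp [N]) (fun j =>
    Ideal.Quotient.eq_zero_iff_mem.2 (Ideal.subset_span ⟨j, rfl⟩)) hc2 h ?_
  have hdet : c.det.IsHomogeneous (∑ j, (N - e j)) := by
    rw [Matrix.det_apply']
    refine MvPolynomial.IsHomogeneous.sum _ _ _ fun s _ => ?_
    have hp := MvPolynomial.IsHomogeneous.prod Finset.univ (fun i => c (s i) i) (fun j => N - e j)
      (fun j _ => hc1 (s j) j)
    rcases Int.units_eq_one_or (Equiv.Perm.sign s) with h | h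
    · rw [h]; simpa using hp
    · rw [h]; simpa using hp.neg
  have hhom := hh.mul hdet
  have hW : Ideal.span (Set.range fun i : σ => (MvPolynomial.X i : MvPolynomial σ k) ^ N)
      = Ideal.span ((fun s => MvPolynomial.monomial s (1 : k)) ''
        (Set.range fun i : σ => Finsupp.single i N)) := by
    rw [← Set.range_comp]
    congr 1
    congr 1
    ext i
    simp [MvPolynomial.X_pow_eq_monomial]
  rw [hW, MvPolynomial.mem_ideal_span_monomial_image]
  intro α hα
  have hdeg := hhom.degree_eq_sum_deg_support hα
  by_contra hcon
  push Not at hcon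
  have hlt : ∀ i, α i ≤ N - 1 := by
    intro i
    have := hcon _ ⟨i, rfl⟩
    by_contra hh
    apply this
    rw [Finsupp.single_le_iff]
    omega
  have hsum : α.degree = ∑ i, α i := by
    rw [Finsupp.degree_eq_sum]
  have hdeg' : α.degree = d + ∑ j, (N - e j) := hdeg.symm
  have h1 : ∑ i, α i ≤ ∑ i : σ, (N - 1) := Finset.sum_le_sum fun i _ => hlt i
  have h2 : ∑ i : σ, (N - 1) = ∑ i, (e i - 1) + ∑ i, (N - e i) := by
    rw [← Finset.sum_add_distrib]
    refine Finset.sum_congr rfl fun i _ => ?_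
    have := heN i; have := he i; omega
  omega

end CasasAux

namespace CasasAux

def shift {F : Type} [Field F] (n : ℕ) (x : Fin (n - 1) → F) (j : Fin n) : Fin (n - 1) → F :=
  if h : (j : ℕ) < n - 1 then
    fun i => if i = ⟨j, h⟩ then - x ⟨j, h⟩ else x i - x ⟨j, h⟩
  else x

def rt {F : Type} [Field F] (n : ℕ) (x : Fin (n - 1) → F) (j : Fin n) : F :=
  if h : (j : ℕ) < n - 1 then x ⟨j, h⟩ else 0

theorem aeval_Phi {F : Type} [Field F] {m : ℕ} (j : Fin m) (x : Fin m → F)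
    (q : MvPolynomial (Fin m) ℤ) :
    MvPolynomial.aeval x (Phi ℤ j q)
      = MvPolynomial.aeval (fun i => if i = j then - x j else x i - x j) q := by
  have : (MvPolynomial.aeval x).comp (Phi ℤ j)
      = MvPolynomial.aeval (fun i => if i = j then - x j else x i - x j) := by
    apply MvPolynomial.algHom_ext
    intro i
    simp only [Phi, AlgHom.comp_apply, MvPolynomial.aeval_X]
    split_ifs <;> simp
  exact DFunLike.congr_fun this q

theorem aeval_G {F : Type} [Field F] (n : ℕ) (T : Fin (n - 1) → Fin n) (i : Fin (n - 1))
    (x : Fin (n - 1) → F) :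
    MvPolynomial.aeval x (G ℤ n T i)
      = (Finset.univ.val.map (shift n x (T i))).esymm ((i : ℕ) + 1) := by
  rw [← MvPolynomial.aeval_esymm_eq_multiset_esymm (Fin (n - 1)) ℤ]
  unfold G PhiFull shift
  split_ifs with h
  · exact aeval_Phi _ _ _
  · rfl

noncomputable def poly {F : Type} [Field F] (n : ℕ) (x : Fin (n - 1) → F) : F[X] :=
  Polynomial.X * ∏ k, (Polynomial.X - Polynomial.C (x k))

theorem taylor_poly {F : Type} [Field F] (n : ℕ) (x : Fin (n - 1) → F) (j : Fin n) :
    Polynomial.taylor (rt n x j) (poly n x) = poly n (shift n x j) := by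
  unfold rt shift
  split_ifs with h
  · set a : Fin (n - 1) := ⟨j, h⟩
    have h1 : Polynomial.taylor (x a) (poly n x) =
        (Polynomial.X + Polynomial.C (x a)) *
          ∏ k, (Polynomial.X + Polynomial.C (x a) - Polynomial.C (x k)) := by
      unfold poly
      rw [Polynomial.taylor_mul, Polynomial.taylor_X, ← Polynomial.taylorAlgHom_apply, map_prod]
      simp
    rw [h1]
    unfold poly
    rw [← Finset.mul_prod_erase _ _ (Finset.mem_univ a),
      ← Finset.mul_prod_erase _ (fun k => Polynomial.X - Polynomial.C
        (if k = a then - x a else x k - x a)) (Finset.mem_univ a)]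
    have h2 : ∏ k ∈ Finset.univ.erase a, (Polynomial.X + Polynomial.C (x a) - Polynomial.C (x k))
        = ∏ k ∈ Finset.univ.erase a,
          (Polynomial.X - Polynomial.C (if k = a then - x a else x k - x a)) := by
      refine Finset.prod_congr rfl fun k hk => ?_
      rw [if_neg (Finset.ne_of_mem_erase hk), Polynomial.C_sub]; ring
    rw [h2, if_pos rfl, Polynomial.C_neg]; ring
  · rw [Polynomial.taylor_zero]

theorem coeff_poly {F : Type} [Field F] (n : ℕ) (x : Fin (n - 1) → F) (i : ℕ) (hi0 : 0 < i)
    (hi : i < n) :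
    (poly n x).coeff i = (-1) ^ (n - i) * (Finset.univ.val.map x).esymm (n - i) := by
  obtain ⟨i, rfl⟩ : ∃ k, i = k + 1 := ⟨i - 1, by omega⟩
  unfold poly
  rw [mul_comm, Polynomial.coeff_mul_X]
  have := Multiset.prod_X_sub_C_coeff (Finset.univ.val.map x) (k := i) (by simp; omega)
  rw [Multiset.map_map] at this
  have e : n - 1 - i = n - (i + 1) := by omega
  rw [Multiset.card_map, Finset.card_val, Finset.card_univ, Fintype.card_fin, e] at this
  exact this

theorem hasse_poly {F : Type} [Field F] (n : ℕ) (x : Fin (n - 1) → F) (i : ℕ) (hi0 : 0 < i)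
    (hi : i < n) (j : Fin n) :
    (Polynomial.hasseDeriv i (poly n x)).eval (rt n x j) = 0 ↔
      (Finset.univ.val.map (shift n x j)).esymm (n - i) = 0 := by
  rw [← Polynomial.taylor_coeff, taylor_poly, coeff_poly _ _ _ hi0 hi]
  simp

theorem poly_monic {F : Type} [Field F] (n : ℕ) (x : Fin (n - 1) → F) : (poly n x).Monic :=
  Polynomial.monic_X.mul (Polynomial.monic_prod_of_monic _ _ fun _ _ => Polynomial.monic_X_sub_C _)

theorem poly_natDegree {F : Type} [Field F] (n : ℕ) (hn : 2 ≤ n) (x : Fin (n - 1) → F) :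
    (poly n x).natDegree = n := by
  unfold poly
  rw [Polynomial.Monic.natDegree_mul Polynomial.monic_X
    (Polynomial.monic_prod_of_monic _ _ fun _ _ => Polynomial.monic_X_sub_C _),
    Polynomial.natDegree_prod_of_monic _ _ (fun _ _ => Polynomial.monic_X_sub_C _)]
  simp; omega

theorem poly_root_iff {F : Type} [Field F] (n : ℕ) (hn : 2 ≤ n) (x : Fin (n - 1) → F) (r : F) :
    (poly n x).eval r = 0 ↔ ∃ j, r = rt n x j := by
  unfold poly
  rw [Polynomial.eval_mul, Polynomial.eval_prod, mul_eq_zero, Finset.prod_eq_zero_iff]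
  simp only [Polynomial.eval_X, Polynomial.eval_sub, Polynomial.eval_C, Finset.mem_univ, true_and,
    sub_eq_zero]
  constructor
  · rintro (h | ⟨k, hk⟩)
    · exact ⟨⟨n - 1, by omega⟩, by simp [rt, h]⟩
    · exact ⟨⟨k, by omega⟩, by simp [rt, hk]⟩
  · rintro ⟨j, hj⟩
    unfold rt at hj
    split_ifs at hj with h
    · exact Or.inr ⟨_, hj⟩
    · exact Or.inl hj

/-- characteristic-zero direction -/
theorem trivial_zero {K : Type} [Field K] (n : ℕ) (hn : 2 ≤ n)
    (hCA : ∀ f : Polynomial K, IsCasasAlvero n f →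
        ∃ b : K, f = (Polynomial.X - Polynomial.C b) ^ n)
    (T : Fin (n - 1) → Fin n) (x : Fin (n - 1) → K)
    (hx : ∀ i, MvPolynomial.aeval x (G ℤ n T i) = 0) : x = 0 := by
  obtain ⟨b, hb⟩ := hCA (poly n x) ⟨poly_monic n x, poly_natDegree n hn x, by
    intro i hi
    rw [Finset.mem_Ioo] at hi
    let i' : Fin (n - 1) := ⟨n - 1 - i, by omega⟩
    refine ⟨Polynomial.X - Polynomial.C (rt n x (T i')), by simp, ?_, ?_⟩
    · rw [Polynomial.dvd_iff_isRoot]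
      exact (poly_root_iff n hn x _).2 ⟨_, rfl⟩
    · rw [Polynomial.dvd_iff_isRoot]
      refine (hasse_poly n x i hi.1 hi.2 _).2 ?_
      have := hx i'
      rw [aeval_G] at this
      have e : (i' : ℕ) + 1 = n - i := by simp only [i']; omega
      rwa [e] at this⟩
  have hroot : ∀ j, rt n x j = b := by
    intro j
    have := (poly_root_iff n hn x _).2 ⟨j, rfl⟩
    rw [hb] at this
    simp only [Polynomial.eval_pow, Polynomial.eval_sub, Polynomial.eval_X, Polynomial.eval_C] at this
    exact sub_eq_zero.1 (pow_eq_zero_iff (by omega) |>.1 this)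
  have hb0 : b = 0 := by
    rw [← hroot ⟨n - 1, by omega⟩]; simp [rt]
  funext k
  have := hroot ⟨k, by omega⟩
  simpa [rt, hb0] using this

/-- characteristic-`p` direction -/
theorem nontrivial_zero {K : Type} [Field K] [IsAlgClosed K] (n : ℕ) (hn : 2 ≤ n)
    (f : K[X]) (hf : IsCasasAlvero n f) (hb : ¬ ∃ b : K, f = (Polynomial.X - Polynomial.C b) ^ n) :
    ∃ (T : Fin (n - 1) → Fin n) (x : Fin (n - 1) → K), x ≠ 0 ∧
      ∀ i, MvPolynomial.aeval x (G ℤ n T i) = 0 := by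
  obtain ⟨hmon, hdeg, hCA⟩ := hf
  have hcard : Multiset.card f.roots = n := by
    rw [← hdeg]; exact Polynomial.splits_iff_card_roots.1 (IsAlgClosed.splits f)
  have hprod := Polynomial.prod_multiset_X_sub_C_of_monic_of_roots_card_eq hmon
    (hcard.trans hdeg.symm)
  obtain ⟨b, hbr⟩ : ∃ b, b ∈ f.roots := by
    apply Multiset.exists_mem_of_ne_zero
    rintro h0; rw [h0] at hcard; simp at hcard; omega
  obtain ⟨s, hs⟩ := Multiset.exists_cons_of_mem hbr
  have hscard : Multiset.card s = n - 1 := by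
    rw [hs, Multiset.card_cons] at hcard; omega
  obtain ⟨r, hr⟩ : ∃ r : Fin (n - 1) → K, s = Finset.univ.val.map r := by
    have hl : s.toList.length = n - 1 := by rw [Multiset.length_toList, hscard]
    rw [← Multiset.coe_toList s]
    generalize s.toList = l at hl
    rw [← hl]
    exact ⟨l.get, by simp⟩
  let x : Fin (n - 1) → K := fun k => r k - b
  have hfx : Polynomial.taylor b f = poly n x := by
    rw [← hprod, hs, Multiset.map_cons, Multiset.prod_cons, hr, Multiset.map_map]
    change Polynomial.taylor b ((Polynomial.X - Polynomial.C b) *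
      ∏ k, (Polynomial.X - Polynomial.C (r k))) = _
    rw [Polynomial.taylor_mul, ← Polynomial.taylorAlgHom_apply, ← Polynomial.taylorAlgHom_apply,
      map_prod]
    simp only [Polynomial.taylorAlgHom_apply, map_sub, Polynomial.taylor_X, Polynomial.taylor_C]
    unfold poly
    congr 1
    · ring
    · refine Finset.prod_congr rfl fun k _ => ?_
      simp only [x, Polynomial.C_sub]; ring
  have hroot : ∀ i : Fin (n - 1), ∃ j : Fin n,
      (Finset.univ.val.map (shift n x j)).esymm ((i : ℕ) + 1) = 0 := by
    intro i
    have hi := i.2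
    obtain ⟨g, hg, hgf, hgh⟩ := hCA (n - 1 - i) (by rw [Finset.mem_Ioo]; omega)
    obtain ⟨t, ht⟩ := IsAlgClosed.exists_root g (by intro h; rw [h] at hg; exact lt_irrefl _ hg)
    have h1 : f.eval t = 0 := ht.dvd hgf
    have h2 : (Polynomial.hasseDeriv (n - 1 - i) f).eval t = 0 := ht.dvd hgh
    have h3 : (poly n x).eval (t - b) = 0 := by
      rw [← hfx, Polynomial.taylor_eval_sub, h1]
    obtain ⟨j, hj⟩ := (poly_root_iff n hn x _).1 h3
    refine ⟨j, ?_⟩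
    have h4 := (hasse_poly n x (n - 1 - i) (by omega) (by omega) j).1 (by
      rw [← hj, ← hfx, ← Polynomial.taylor_coeff, Polynomial.taylor_taylor, sub_add_cancel,
        Polynomial.taylor_coeff, h2])
    have e : n - (n - 1 - (i : ℕ)) = i + 1 := by omega
    rwa [e] at h4
  choose T hT using hroot
  refine ⟨T, x, ?_, fun i => by rw [aeval_G, hT]⟩
  intro hx0
  apply hb
  refine ⟨b, ?_⟩
  apply Polynomial.taylor_injective b
  rw [hfx, hx0, Polynomial.taylor_pow]
  unfold poly
  simp only [Pi.zero_apply, Polynomial.C_0, sub_zero, Finset.prod_const, Finset.card_univ,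
    Fintype.card_fin, map_sub, Polynomial.taylor_X, Polynomial.taylor_C, add_sub_cancel_right]
  rw [← pow_succ']
  congr 1; omega

end CasasAux

namespace CasasAux

theorem esymm_hom (m e : ℕ) : (MvPolynomial.esymm (Fin m) ℤ e).IsHomogeneous e := by
  unfold MvPolynomial.esymm
  refine MvPolynomial.IsHomogeneous.sum _ _ _ fun t ht => ?_
  have := MvPolynomial.IsHomogeneous.prod t (fun i => (MvPolynomial.X i : MvPolynomial (Fin m) ℤ))
    (fun _ => 1) (fun i _ => MvPolynomial.isHomogeneous_X _ _)
  simpa [(Finset.mem_powersetCard.1 ht).2] using this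

theorem G_hom (n : ℕ) (T : Fin (n - 1) → Fin n) (i : Fin (n - 1)) :
    (G ℤ n T i).IsHomogeneous ((i : ℕ) + 1) := by
  unfold G PhiFull
  split_ifs with h
  · unfold Phi
    have := (esymm_hom (n - 1) (i + 1)).aeval (n := 1) (S := ℤ) (fun k : Fin (n - 1) =>
      if k = ⟨(T i : ℕ), h⟩ then -MvPolynomial.X (⟨(T i : ℕ), h⟩ : Fin (n - 1))
        else MvPolynomial.X k - MvPolynomial.X ⟨(T i : ℕ), h⟩) (by
        intro k
        split_ifs
        · exact (MvPolynomial.isHomogeneous_X _ _).neg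
        · exact (MvPolynomial.isHomogeneous_X _ _).sub (MvPolynomial.isHomogeneous_X _ _))
    simpa using this
  · exact esymm_hom _ _

theorem coeff_prod_bound {m : ℕ} (j : Fin m) (S : Finset (Fin m)) :
    ∀ α : Fin m →₀ ℕ,
      |MvPolynomial.coeff α (∏ k ∈ S, (if k = j then -MvPolynomial.X j
        else MvPolynomial.X k - MvPolynomial.X j : MvPolynomial (Fin m) ℤ))| ≤ 1 ∧
      (MvPolynomial.coeff α (∏ k ∈ S, (if k = j then -MvPolynomial.X j
        else MvPolynomial.X k - MvPolynomial.X j : MvPolynomial (Fin m) ℤ)) ≠ 0 →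
        ∀ k, k ∉ S → k ≠ j → α k = 0) := by
  induction S using Finset.induction_on with
  | empty =>
    intro α
    simp only [Finset.prod_empty, MvPolynomial.coeff_one]
    split_ifs with h
    · subst h; simp
    · simp
  | insert a S ha ih =>
    rw [Finset.prod_insert ha]
    generalize (∏ k ∈ S, (if k = j then -MvPolynomial.X j
        else MvPolynomial.X k - MvPolynomial.X j : MvPolynomial (Fin m) ℤ)) = q at ih
    have hXq : ∀ (b : Fin m) (α : Fin m →₀ ℕ), MvPolynomial.coeff α (MvPolynomial.X b * q) ≠ 0 →
        α b ≠ 0 ∧ ∀ k, k ∉ S → k ≠ j → k ≠ b → α k = 0 := by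
      intro b α h
      rw [MvPolynomial.coeff_X_mul'] at h
      split_ifs at h with hb
      · refine ⟨by simpa using hb, fun k hk hkj hkb => ?_⟩
        have := (ih _).2 h k hk hkj
        simpa [Finsupp.single_apply, Ne.symm hkb] using this
      · exact absurd rfl h
    have hX1 : ∀ (b : Fin m) (α : Fin m →₀ ℕ),
        |MvPolynomial.coeff α (MvPolynomial.X b * q)| ≤ 1 := by
      intro b α
      rw [MvPolynomial.coeff_X_mul']
      split_ifs
      · exact (ih _).1
      · simp
    intro α
    by_cases haj : a = j
    · rw [if_pos haj, neg_mul, MvPolynomial.coeff_neg, abs_neg, neg_ne_zero]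
      refine ⟨hX1 j α, fun h k hk hkj => (hXq j α h).2 k (fun h => hk ?_) hkj hkj⟩
      exact Finset.mem_insert_of_mem h
    · rw [if_neg haj, sub_mul, MvPolynomial.coeff_sub]
      by_cases h0 : MvPolynomial.coeff α (MvPolynomial.X j * q) = 0
      · rw [h0, sub_zero]
        refine ⟨hX1 a α, fun h k hk hkj => (hXq a α h).2 k (fun h => hk ?_) hkj ?_⟩
        · exact Finset.mem_insert_of_mem h
        · rintro rfl; exact hk (Finset.mem_insert_self _ _)
      · have h1 : MvPolynomial.coeff α (MvPolynomial.X a * q) = 0 := by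
          by_contra h1
          exact (hXq a α h1).1 ((hXq j α h0).2 a ha haj haj)
        rw [h1, zero_sub, abs_neg, neg_ne_zero]
        refine ⟨hX1 j α, fun h k hk hkj => (hXq j α h).2 k (fun h => hk ?_) hkj hkj⟩
        exact Finset.mem_insert_of_mem h

theorem G_coeff_bound (n : ℕ) (hn : 2 ≤ n) (T : Fin (n - 1) → Fin n) (i : Fin (n - 1))
    (α : Fin (n - 1) →₀ ℕ) :
    |MvPolynomial.coeff α (G ℤ n T i)| ≤ Nat.choose ((i : ℕ) + 1 + n - 2) (n - 2) := by
  have hch : Nat.choose (n - 1) (i + 1) ≤ Nat.choose ((i : ℕ) + 1 + n - 2) (n - 2) := by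
    have e : (i : ℕ) + 1 + n - 2 = (i + 1) + (n - 2) := by omega
    rw [e, ← Nat.choose_symm_add]
    exact Nat.choose_le_choose _ (by omega)
  suffices h : |MvPolynomial.coeff α (G ℤ n T i)| ≤ Nat.choose (n - 1) (i + 1) from
    h.trans (by exact_mod_cast hch)
  have gen : ∀ P : Finset (Fin (n - 1)) → MvPolynomial (Fin (n - 1)) ℤ,
      (∀ S, |MvPolynomial.coeff α (P S)| ≤ 1) →
      |MvPolynomial.coeff α (∑ S ∈ Finset.powersetCard (i + 1) Finset.univ, P S)|
        ≤ Nat.choose (n - 1) (i + 1) := by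
    intro P hP
    rw [MvPolynomial.coeff_sum]
    refine (Finset.abs_sum_le_sum_abs _ _).trans ?_
    refine (Finset.sum_le_card_nsmul _ _ 1 fun S _ => hP S).trans ?_
    simp [Finset.card_powersetCard]
  unfold G PhiFull
  split_ifs with h
  · unfold Phi MvPolynomial.esymm
    rw [map_sum]
    apply gen
    intro S
    rw [map_prod]
    simp only [MvPolynomial.aeval_X]
    exact (coeff_prod_bound ⟨(T i : ℕ), h⟩ S α).1
  · unfold MvPolynomial.esymm
    rw [AlgHom.id_apply]
    apply gen
    intro S
    have : (∏ k ∈ S, (MvPolynomial.X k : MvPolynomial (Fin (n - 1)) ℤ))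
        = MvPolynomial.monomial (∑ k ∈ S, Finsupp.single k 1) 1 := by
      rw [MvPolynomial.monomial_sum_one]; rfl
    rw [this, MvPolynomial.coeff_monomial]
    split_ifs <;> simp

theorem toFinsupp_inj {m e : ℕ} (s t : Sym (Fin m) e) :
    Multiset.toFinsupp (s : Multiset (Fin m)) = Multiset.toFinsupp (t : Multiset (Fin m)) ↔ s = t := by
  rw [EmbeddingLike.apply_eq_iff_eq, Sym.coe_inj]

theorem degree_toFinsupp {m e : ℕ} (s : Sym (Fin m) e) :
    (Multiset.toFinsupp (s : Multiset (Fin m))).degree = e := by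
  rw [Finsupp.degree_eq_sum]
  simp only [Multiset.toFinsupp_apply]
  rw [Multiset.sum_count_eq_card (by simp)]
  exact s.2

theorem hom_expand {m e : ℕ} {R : Type*} [CommRing R] (q : MvPolynomial (Fin m) R)
    (hq : q.IsHomogeneous e) :
    q = ∑ s : Sym (Fin m) e, MvPolynomial.monomial (Multiset.toFinsupp (s : Multiset (Fin m)))
      (MvPolynomial.coeff (Multiset.toFinsupp (s : Multiset (Fin m))) q) := by
  ext α
  rw [MvPolynomial.coeff_sum]
  simp only [MvPolynomial.coeff_monomial]
  by_cases hα : α.degree = e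
  · let s : Sym (Fin m) e := ⟨Finsupp.toMultiset α, by
      rw [Finsupp.card_toMultiset, ← hα]; rfl⟩
    have hs : Multiset.toFinsupp (s : Multiset (Fin m)) = α := by
      change Multiset.toFinsupp (Finsupp.toMultiset α) = α
      simp
    rw [Finset.sum_eq_single s]
    · rw [if_pos hs, hs]
    · intro t _ hts
      rw [if_neg]
      intro h
      exact hts ((toFinsupp_inj t s).1 (h.trans hs.symm))
    · simp
  · rw [hq.coeff_eq_zero hα, Finset.sum_eq_zero]
    intro s _
    rw [if_neg]
    rintro rfl
    exact hα (degree_toFinsupp s)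

theorem exists_minor {R C K : Type*} [Fintype R] [Fintype C] [DecidableEq R] [DecidableEq C] [Field K]
    (M : Matrix R C K) (L : Matrix C R K) (h : L * M = 1) :
    ∃ f : C → R, (M.submatrix f id).det ≠ 0 := by
  by_contra hcon
  push Not at hcon
  have h1 : (L * M).det = 0 := by
    have e : L * M = Matrix.of fun c => ∑ r, L c r • M r := by
      ext c c'
      simp [Matrix.mul_apply, Finset.sum_apply]
    have := (Matrix.detRowAlternating (n := C) (R := K)).toMultilinearMap.map_sum
      (fun c r => L c r • M r)
    rw [e]
    refine Eq.trans this ?_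
    refine Finset.sum_eq_zero fun f _ => ?_
    have h2 := (Matrix.detRowAlternating (n := C) (R := K)).toMultilinearMap.map_smul_univ
      (fun c => L c (f c)) (fun c => M (f c))
    refine h2.trans ?_
    have h3 : (Matrix.detRowAlternating (n := C) (R := K)).toMultilinearMap (fun c => M (f c)) = 0 :=
      hcon f
    rw [h3, smul_zero]
  rw [h, Matrix.det_one] at h1
  exact one_ne_zero h1

theorem casasD_ge (n : ℕ) (hn : 2 ≤ n) : n - 1 ≤ casasD n := by
  unfold casasD
  rw [Nat.le_div_iff_mul_le (by norm_num)]
  obtain ⟨m, rfl⟩ : ∃ m, n = m + 2 := ⟨n - 2, by omega⟩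
  have : (m + 2) ^ 2 = m ^ 2 + 4 * m + 4 := by ring
  rcases m with _ | _ | m
  · simp
  · simp
  · have : (m + 1 + 1 + 2) ^ 2 = m ^ 2 + 8 * m + 16 := by ring
    omega

theorem two_casasD (n : ℕ) (hn : 3 ≤ n) : 2 * casasD n + 3 * n = n ^ 2 + 4 := by
  unfold casasD
  obtain ⟨m, rfl⟩ : ∃ m, n = m + 3 := ⟨n - 3, by omega⟩
  have h1 : (m + 3) ^ 2 = m * (m + 1) + 5 * m + 9 := by ring
  have h2 : m * (m + 1) % 2 = 0 := Nat.even_iff.1 (Nat.even_mul_succ_self m)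
  omega

theorem sum_deg (n : ℕ) (hn : 2 ≤ n) :
    ∑ i : Fin (n - 1), ((i : ℕ) + 1 - 1) + 1 ≤ casasD n := by
  rcases hn.eq_or_lt with rfl | hn
  · simp [casasD]
  have h := two_casasD n hn
  simp only [Nat.add_sub_cancel]
  rw [Fin.sum_univ_eq_sum_range (fun i => i) (n - 1)]
  have h2 := Finset.sum_range_id_mul_two (n - 1)
  obtain ⟨m, rfl⟩ : ∃ m, n = m + 2 := ⟨n - 2, by omega⟩
  have e1 : m + 2 - 1 = m + 1 := by omega
  have e2 : m + 1 - 1 = m := by omega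
  rw [e1] at h2 ⊢
  rw [e2] at h2
  nlinarith

theorem card_sym_fin (n : ℕ) (hn : 2 ≤ n) (e : ℕ) :
    Fintype.card (Sym (Fin (n - 1)) e) = Nat.choose (e + n - 2) (n - 2) := by
  rw [Sym.card_sym_eq_choose, Fintype.card_fin]
  have e1 : n - 1 + e - 1 = e + (n - 2) := by omega
  have e2 : e + n - 2 = e + (n - 2) := by omega
  rw [e1, e2, Nat.choose_symm_add]

theorem card_cols (n : ℕ) (hn : 2 ≤ n) :
    Fintype.card (Sym (Fin (n - 1)) (casasD n)) = casasC n := by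
  rw [card_sym_fin n hn, casasC]
  rcases hn.eq_or_lt with rfl | hn
  · simp
  congr 1
  have h := two_casasD n hn
  obtain ⟨m, rfl⟩ : ∃ m, n = m + 2 := ⟨n - 2, by omega⟩
  have h1 : (m + 2) ^ 2 = m * (m + 1) + 3 * m + 4 := by ring
  omega

theorem casasC_ge (n : ℕ) (hn : 3 ≤ n) : 3 ≤ casasC n := by
  unfold casasC
  obtain ⟨m, rfl⟩ : ∃ m, n = m + 3 := ⟨n - 3, by omega⟩
  have h1 : m + 3 ≤ ((m + 3) ^ 2 - (m + 3)) / 2 := by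
    rw [Nat.le_div_iff_mul_le (by norm_num)]
    have : (m + 3) ^ 2 = m ^ 2 + 6 * m + 9 := by ring
    omega
  calc 3 ≤ m + 3 := by omega
    _ ≤ Nat.choose (m + 3) (m + 1) := by
      rw [show m + 3 = (m + 1) + 2 by ring, Nat.choose_symm_add]
      rw [show m + 1 + 2 = m + 3 by ring, Nat.choose_two_right, Nat.le_div_iff_mul_le (by norm_num)]
      exact Nat.mul_le_mul_left _ (by omega)
    _ ≤ _ := by
      rw [show m + 3 - 2 = m + 1 by omega]
      exact Nat.choose_le_choose _ h1

theorem det_bound {R C : Type*} [Fintype R] [Fintype C] [DecidableEq R] [DecidableEq C]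
    (M : Matrix R C ℤ) (B : R → ℕ) (hB1 : ∀ r, 1 ≤ B r) (hB : ∀ r c, |M r c| ≤ B r)
    (f : C → R) (hf : Function.Injective f) :
    (M.submatrix f id).det.natAbs ≤ (Fintype.card C).factorial * ∏ r, B r := by
  have h1 : |(M.submatrix f id).det| ≤ ((Fintype.card C).factorial : ℤ) * ∏ c, (B (f c) : ℤ) := by
    rw [Matrix.det_apply]
    refine (Finset.abs_sum_le_sum_abs _ _).trans ?_
    refine (Finset.sum_le_card_nsmul _ _ (∏ c, (B (f c) : ℤ)) fun s _ => ?_).trans ?_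
    · have : |Equiv.Perm.sign s • ∏ i, (M.submatrix f id) (s i) i|
          = |∏ i, (M.submatrix f id) (s i) i| := by
        rcases Int.units_eq_one_or (Equiv.Perm.sign s) with h | h <;> rw [h] <;> simp
      rw [this, Finset.abs_prod, ← Equiv.prod_comp s (fun c => (B (f c) : ℤ))]
      exact Finset.prod_le_prod (fun _ _ => abs_nonneg _) fun i _ => hB _ _
    · rw [Finset.card_univ, Fintype.card_perm, nsmul_eq_mul]
  have h2 : ∏ c, B (f c) ≤ ∏ r, B r := by
    rw [← Finset.prod_image (s := Finset.univ) (g := f) (f := B) hf.injOn]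
    exact Finset.prod_le_prod_of_subset_of_one_le' (Finset.subset_univ _) fun r _ _ => hB1 r
  have h3 : ((M.submatrix f id).det.natAbs : ℤ)
      ≤ ((Fintype.card C).factorial : ℤ) * ∏ c, (B (f c) : ℤ) := by
    rw [Int.natCast_natAbs]; exact h1
  refine le_trans ?_ (Nat.mul_le_mul_left _ h2)
  exact_mod_cast h3

end CasasAux

namespace CasasAux

/-- existence of a nonzero maximal minor -/
theorem exists_int_minor (n : ℕ) (hn : 2 ≤ n) (T : Fin (n - 1) → Fin n)
    (K : Type) [Field K] [IsAlgClosed K] [CharZero K]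
    (hz : ∀ x : Fin (n - 1) → K, (∀ i, MvPolynomial.aeval x (G ℤ n T i) = 0) → x = 0) :
    ∃ f, ((casasM n T).submatrix f id).det ≠ 0 := by
  classical
  let F : Fin (n - 1) → MvPolynomial (Fin (n - 1)) K := fun i =>
    MvPolynomial.map (Int.castRingHom K) (G ℤ n T i)
  have hF : ∀ i, (F i).IsHomogeneous ((i : ℕ) + 1) := fun i => (G_hom n T i).map _
  have hrad : ∀ i, (MvPolynomial.X i : MvPolynomial (Fin (n - 1)) K)
      ∈ (Ideal.span (Set.range F)).radical := by
    intro i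
    rw [← MvPolynomial.vanishingIdeal_zeroLocus_eq_radical (K := K)]
    rw [MvPolynomial.mem_vanishingIdeal_iff]
    intro x hx
    rw [MvPolynomial.zeroLocus_span] at hx
    have : x = 0 := by
      apply hz
      intro k
      have := hx _ ⟨k, rfl⟩
      simp only [F] at this
      rw [MvPolynomial.aeval_def, MvPolynomial.eval₂_map] at this
      have e : (algebraMap K K).comp (Int.castRingHom K) = algebraMap ℤ K := RingHom.ext_int _ _
      rw [e] at this
      rw [MvPolynomial.aeval_def]
      exact this
    simp [this]
  have hdi : ∀ i : Fin (n - 1), (i : ℕ) + 1 ≤ casasD n := fun i => by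
    have := casasD_ge n hn; omega
  have hmem : ∀ c : Sym (Fin (n - 1)) (casasD n), ∃ q : Fin (n - 1) → MvPolynomial (Fin (n - 1)) K,
      (∀ i, (q i).IsHomogeneous (casasD n - ((i : ℕ) + 1))) ∧
      MvPolynomial.monomial (Multiset.toFinsupp (c : Multiset (Fin (n - 1)))) (1 : K)
        = ∑ i, q i * F i := by
    intro c
    have hc : (MvPolynomial.monomial (Multiset.toFinsupp (c : Multiset (Fin (n - 1)))) (1 : K)).IsHomogeneous
      (casasD n) := MvPolynomial.isHomogeneous_monomial _ (degree_toFinsupp c)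
    exact hom_coeffs F (fun i => (i : ℕ) + 1) hF _ hdi _ hc
      (macaulay F (fun i => (i : ℕ) + 1) hF (fun i => by omega) hrad _ (sum_deg n hn) _ hc)
  choose q hq1 hq2 using hmem
  let M : Matrix ((i : Fin (n - 1)) × Sym (Fin (n - 1)) (casasD n - ((i : ℕ) + 1)))
      (Sym (Fin (n - 1)) (casasD n)) K := (casasM n T).map (Int.castRingHom K)
  let L : Matrix (Sym (Fin (n - 1)) (casasD n))
    ((i : Fin (n - 1)) × Sym (Fin (n - 1)) (casasD n - ((i : ℕ) + 1))) K :=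
    Matrix.of fun c r => MvPolynomial.coeff (Multiset.toFinsupp (r.2 : Multiset (Fin (n - 1)))) (q c r.1)
  have hM : ∀ r c, M r c = MvPolynomial.coeff (Multiset.toFinsupp (c : Multiset (Fin (n - 1))))
      (MvPolynomial.monomial (Multiset.toFinsupp (r.2 : Multiset (Fin (n - 1)))) 1 * F r.1) := by
    intro r c
    simp only [M, Matrix.map_apply, casasM, F]
    rw [← MvPolynomial.coeff_map, map_mul, MvPolynomial.map_monomial, map_one]
  have hLM : L * M = 1 := by
    ext c c'
    rw [Matrix.mul_apply, Fintype.sum_sigma]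
    have h1 : ∀ i : Fin (n - 1), ∑ s : Sym (Fin (n - 1)) (casasD n - ((i : ℕ) + 1)),
        L c ⟨i, s⟩ * M ⟨i, s⟩ c'
        = MvPolynomial.coeff (Multiset.toFinsupp (c' : Multiset (Fin (n - 1)))) (q c i * F i) := by
      intro i
      conv_rhs => rw [hom_expand (q c i) (hq1 c i), Finset.sum_mul, MvPolynomial.coeff_sum]
      refine Finset.sum_congr rfl fun s _ => ?_
      rw [hM, ← MvPolynomial.coeff_C_mul, ← mul_assoc, MvPolynomial.C_mul_monomial, mul_one]
      rfl
    rw [Finset.sum_congr rfl fun i _ => h1 i, ← MvPolynomial.coeff_sum, ← hq2,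
      MvPolynomial.coeff_monomial, Matrix.one_apply]
    simp only [toFinsupp_inj]
  obtain ⟨f, hf⟩ := exists_minor M L hLM
  refine ⟨f, fun h0 => hf ?_⟩
  have : M.submatrix f id = ((casasM n T).submatrix f id).map (Int.castRingHom K) := rfl
  rw [this, ← RingHom.mapMatrix_apply, ← RingHom.map_det, h0, map_zero]

theorem minor_zero (n : ℕ) (hn : 2 ≤ n) (T : Fin (n - 1) → Fin n)
    (K : Type) [Field K] (x : Fin (n - 1) → K) (hx0 : x ≠ 0)
    (hx : ∀ i, MvPolynomial.aeval x (G ℤ n T i) = 0)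
    (f : Sym (Fin (n - 1)) (casasD n) →
      (i : Fin (n - 1)) × Sym (Fin (n - 1)) (casasD n - ((i : ℕ) + 1))) :
    ((((casasM n T).submatrix f id).det : ℤ) : K) = 0 := by
  classical
  let v : Sym (Fin (n - 1)) (casasD n) → K := fun c =>
    MvPolynomial.aeval x (MvPolynomial.monomial
      (Multiset.toFinsupp (c : Multiset (Fin (n - 1)))) (1 : ℤ))
  have hv : v ≠ 0 := by
    obtain ⟨k, hk⟩ := Function.ne_iff.1 hx0
    intro h
    have := congrFun h (Sym.replicate (casasD n) k)
    simp only [v, Pi.zero_apply, MvPolynomial.aeval_monomial, map_one, one_mul,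
      Sym.coe_replicate, Finsupp.prod] at this
    rw [Finset.prod_eq_zero_iff] at this
    obtain ⟨a, ha, ha'⟩ := this
    rw [Finsupp.mem_support_iff, Multiset.toFinsupp_apply, Multiset.count_replicate] at ha
    split_ifs at ha with hka
    · subst hka
      exact pow_ne_zero _ (by simpa using hk) ha'
    · exact ha rfl
  have hrow : ∀ r, ∑ c, ((casasM n T r c : ℤ) : K) * v c = 0 := by
    intro r
    have hhom : (MvPolynomial.monomial (Multiset.toFinsupp (r.2 : Multiset (Fin (n - 1)))) (1 : ℤ)
        * G ℤ n T r.1).IsHomogeneous (casasD n) := by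
      have h1 := (MvPolynomial.isHomogeneous_monomial (1 : ℤ) (degree_toFinsupp r.2)).mul
        (G_hom n T r.1)
      have e : casasD n - ((r.1 : ℕ) + 1) + ((r.1 : ℕ) + 1) = casasD n := by
        have := casasD_ge n hn
        omega
      rwa [e] at h1
    have h2 := congrArg (MvPolynomial.aeval x) (hom_expand _ hhom)
    rw [map_mul, hx, mul_zero, map_sum] at h2
    rw [h2]
    refine Finset.sum_congr rfl fun c _ => ?_
    simp only [v, MvPolynomial.aeval_monomial, casasM, map_one, one_mul]
    simp
  have hdet : (((casasM n T).submatrix f id).map (Int.castRingHom K)).det = 0 := by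
    apply Matrix.exists_mulVec_eq_zero_iff.1
    refine ⟨v, hv, ?_⟩
    ext c
    exact hrow (f c)
  rw [← RingHom.mapMatrix_apply, ← RingHom.map_det] at hdet
  exact hdet

theorem bound_eq (n : ℕ) (hn : 2 ≤ n) :
    casasBound n = (Fintype.card (Sym (Fin (n - 1)) (casasD n))).factorial *
      ∏ r : (i : Fin (n - 1)) × Sym (Fin (n - 1)) (casasD n - ((i : ℕ) + 1)),
        Nat.choose ((r.1 : ℕ) + 1 + n - 2) (n - 2) := by
  rw [casasBound, card_cols n hn, Fintype.prod_sigma]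
  congr 1
  simp only [Finset.prod_const, Finset.card_univ]
  have h : ∀ i : Fin (n - 1),
      Nat.choose ((i : ℕ) + 1 + n - 2) (n - 2) ^
        Fintype.card (Sym (Fin (n - 1)) (casasD n - ((i : ℕ) + 1)))
      = (fun k => Nat.choose (k + 1 + n - 2) (n - 2) ^
        Nat.choose (casasD n - (k + 1) + n - 2) (n - 2)) (i : ℕ) := by
    intro i; rw [card_sym_fin n hn]
  rw [Finset.prod_congr rfl fun i _ => h i, Fin.prod_univ_eq_prod_range
      (fun k => Nat.choose (k + 1 + n - 2) (n - 2) ^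
        Nat.choose (casasD n - (k + 1) + n - 2) (n - 2)) (n - 1),
    ← Finset.Ico_add_one_right_eq_Icc, Finset.prod_Ico_eq_prod_range]
  refine Finset.prod_congr (by congr 1) fun k _ => ?_
  simp only [Nat.zero_add, Nat.add_comm 1 k]

end CasasAux

/-- **Corollary.** If the Casas–Alvero conjecture holds in degree `n` over algebraically closed
fields of characteristic `0`, then every bad prime for `n` is less than
`C! · ∏_{i=1}^{n-1} binom(i+n-2, n-2)^binom(d-i+n-2, n-2)`. -/
theorem badPrime_lt_bound (n : ℕ) (hn : 2 ≤ n)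
    (hCA0 : ∀ (K : Type) [Field K] [IsAlgClosed K] [CharP K 0],
      ∀ f : Polynomial K, IsCasasAlvero n f →
        ∃ b : K, f = (Polynomial.X - Polynomial.C b) ^ n)
    (p : ℕ) (hp : IsBadPrime n p) : p < casasBound n := by
  classical
  obtain ⟨hprime, K, hK, hac, hchar, g, hg, hgn⟩ := hp
  obtain ⟨T, x, hx0, hx⟩ := CasasAux.nontrivial_zero n hn g hg hgn
  obtain ⟨f, hf⟩ := CasasAux.exists_int_minor n hn T (AlgebraicClosure ℚ) (fun x hx =>
    CasasAux.trivial_zero n hn (hCA0 (AlgebraicClosure ℚ)) T x hx)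
  have hinj : Function.Injective f := by
    intro a b hab
    by_contra hne
    exact hf (Matrix.det_zero_of_row_eq hne (by ext c; simp [hab]))
  have hdvd : (p : ℤ) ∣ ((casasM n T).submatrix f id).det :=
    (CharP.intCast_eq_zero_iff K p _).1 (CasasAux.minor_zero n hn T K x hx0 hx f)
  have hle : p ≤ ((casasM n T).submatrix f id).det.natAbs :=
    Nat.le_of_dvd (Int.natAbs_pos.2 hf) (Int.natCast_dvd.1 hdvd)
  have hB := CasasAux.det_bound (casasM n T)
    (fun r => Nat.choose ((r.1 : ℕ) + 1 + n - 2) (n - 2))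
    (fun r => Nat.choose_pos (by omega)) (by
      intro r c
      unfold casasM
      rw [MvPolynomial.coeff_monomial_mul']
      split_ifs
      · rw [one_mul]; exact CasasAux.G_coeff_bound n hn T r.1 _
      · simp) f hinj
  rw [← CasasAux.bound_eq n hn] at hB
  refine lt_of_le_of_ne (hle.trans hB) ?_
  intro heq
  rcases hn.eq_or_lt with rfl | hn3
  · have h1 : casasBound 2 = 1 := by simp [casasBound, casasC]
    rw [h1] at heq
    exact hprime.one_lt.ne' heq
  · have h3 := CasasAux.casasC_ge n hn3
    have d2 : 2 ∣ p := by
      rw [heq, casasBound]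
      exact Dvd.dvd.mul_right (Nat.dvd_factorial (by norm_num) (by omega)) _
    have d3 : 3 ∣ p := by
      rw [heq, casasBound]
      exact Dvd.dvd.mul_right (Nat.dvd_factorial (by norm_num) (by omega)) _
    have e2 := (Nat.prime_dvd_prime_iff_eq Nat.prime_two hprime).1 d2
    have e3 := (Nat.prime_dvd_prime_iff_eq Nat.prime_three hprime).1 d3
    omega
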